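/- arXiv:1610.02934 — 3 statements merged into one kernel-verified Lean document; each statement's English description precedes it below -/
import Mathlib

section
/- Let T be a triangulation of the completed ∞-gon and n ∈ ℤ. If T contains a right fountain at n, then the Prüfer curve π_n belongs to T; and if T contains a left fountain at n, then the adic curve α_n belongs to T. -/
open scoped Classical

/-- Vertices of the completed ∞-gon: `ℤ ∪ {−∞, +∞}` with the extended linear order. -/
abbrev Vtx : Type := WithBot (WithTop ℤ)

/-- The vertex corresponding to an integer. -/
def vInt (m : ℤ) : Vtx := ((m : WithTop ℤ) : Vtx)

/-- The vertex `+∞`. -/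
def vTop : Vtx := ((⊤ : WithTop ℤ) : Vtx)

/-- The vertex `−∞`. -/
def vBot : Vtx := (⊥ : Vtx)

/-- An arc of the completed ∞-gon: a pair of vertices `src < tgt` such that if both
endpoints are integers then they differ by at least `2`. -/
structure Arc where
  src : Vtx
  tgt : Vtx
  lt : src < tgt
  sep : ∀ m n : ℤ, src = vInt m → tgt = vInt n → m + 2 ≤ n

/-- Two arcs `(a,b)` and `(c,d)` cross if `a < c < b < d` or `c < a < d < b`. -/
def Cross (x y : Arc) : Prop :=
  (x.src < y.src ∧ y.src < x.tgt ∧ x.tgt < y.tgt) ∨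
  (y.src < x.src ∧ x.src < y.tgt ∧ y.tgt < x.tgt)

/-- A triangulation of the completed ∞-gon: a maximal set of pairwise compatible
(= non-crossing) arcs. -/
def IsTriangulation (T : Set Arc) : Prop :=
  (∀ x ∈ T, ∀ y ∈ T, ¬ Cross x y) ∧
  ∀ γ : Arc, (∀ x ∈ T, ¬ Cross γ x) → γ ∈ T

lemma vInt_lt_vTop (m : ℤ) : vInt m < vTop := by
  simpa [vInt, vTop] using WithBot.coe_lt_coe.mpr (WithTop.coe_lt_top (m : ℤ))

lemma vBot_lt_vInt (m : ℤ) : vBot < vInt m := WithBot.bot_lt_coe _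

lemma vBot_lt_vTop : vBot < vTop := WithBot.bot_lt_coe _

lemma vTop_ne_vInt (n : ℤ) : vTop ≠ vInt n := by simp [vTop, vInt]

lemma vBot_ne_vInt (n : ℤ) : vBot ≠ vInt n := by simp [vBot, vInt]

/-- The Prüfer curve `π_m = (m, +∞)`. -/
def prufer (m : ℤ) : Arc :=
  ⟨vInt m, vTop, vInt_lt_vTop m, fun _ n _ h => absurd h (vTop_ne_vInt n)⟩

/-- The adic curve `α_m = (−∞, m)`. -/
def adic (m : ℤ) : Arc :=
  ⟨vBot, vInt m, vBot_lt_vInt m, fun k _ h _ => absurd h (vBot_ne_vInt k)⟩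

/-- The generic curve `z = (−∞, +∞)`. -/
def generic : Arc :=
  ⟨vBot, vTop, vBot_lt_vTop, fun k _ h _ => absurd h (vBot_ne_vInt k)⟩

/-- `T` contains an arc with endpoints `x` and `y`. -/
def HasArc (T : Set Arc) (x y : Vtx) : Prop := ∃ γ ∈ T, γ.src = x ∧ γ.tgt = y

/-- `T` has a right fountain at the integer `n`. -/
def RightFountainInt (T : Set Arc) (n : ℤ) : Prop :=
  {p : ℤ | HasArc T (vInt n) (vInt p)}.Infinite

/-- `T` has a left fountain at the integer `n`. -/
def LeftFountainInt (T : Set Arc) (n : ℤ) : Prop :=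
  {p : ℤ | HasArc T (vInt p) (vInt n)}.Infinite

/-- `T` has a right fountain at the vertex `v`. -/
def RightFountain (T : Set Arc) (v : Vtx) : Prop :=
  (∃ n : ℤ, v = vInt n ∧ RightFountainInt T n) ∨
  (v = vTop ∧ {p : ℤ | 0 ≤ p ∧ prufer p ∈ T}.Infinite) ∨
  (v = vBot ∧ {p : ℤ | 0 ≤ p ∧ adic p ∈ T}.Infinite)

/-- `T` has a left fountain at the vertex `v`. -/
def LeftFountain (T : Set Arc) (v : Vtx) : Prop :=
  (∃ n : ℤ, v = vInt n ∧ LeftFountainInt T n) ∨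
  (v = vTop ∧ {p : ℤ | p ≤ 0 ∧ prufer p ∈ T}.Infinite) ∨
  (v = vBot ∧ {p : ℤ | p ≤ 0 ∧ adic p ∈ T}.Infinite)

/-- `T` is locally finite if every vertex is an endpoint of only finitely many arcs of `T`. -/
def LocallyFin (T : Set Arc) : Prop :=
  ∀ v : Vtx, {γ | γ ∈ T ∧ (γ.src = v ∨ γ.tgt = v)}.Finite

/-- An arc is peripheral if both endpoints are integers. -/
def IsPeripheral (γ : Arc) : Prop :=
  (∃ m : ℤ, γ.src = vInt m) ∧ ∃ n : ℤ, γ.tgt = vInt n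

/-- `γ'` is an exchange partner for `γ` relative to `T`:
it is distinct from `γ` and `(T \ {γ}) ∪ {γ'}` is again a triangulation. -/
def MutExchange (T : Set Arc) (γ γ' : Arc) : Prop :=
  γ' ≠ γ ∧ IsTriangulation ((T \ {γ}) ∪ {γ'})

/-- `γ` is a mutable arc of `T`. -/
def IsMutable (T : Set Arc) (γ : Arc) : Prop :=
  γ ∈ T ∧ ∃ γ', MutExchange T γ γ'

/-- The (unique) replacement arc of `γ` in `T`, when `γ` is mutable. -/
noncomputable def flipArc (T : Set Arc) (γ : Arc) : Arc :=
  if h : ∃ γ', MutExchange T γ γ' then h.choose else γ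

/-- The mutation `μ_γ(T)` of `T` at `γ`. -/
noncomputable def mutate (T : Set Arc) (γ : Arc) : Set Arc :=
  (T \ {γ}) ∪ {flipArc T γ}

/-- `μ_γ(δ)`: the effect of the mutation of `T` at `γ` on the arc `δ`. -/
noncomputable def mutArc (T : Set Arc) (γ δ : Arc) : Arc :=
  if δ = γ then flipArc T γ else δ

/-- One step of a mutation sequence on a set of arcs (`none` = no entry). -/
noncomputable def stepT (T : Set Arc) : Option Arc → Set Arc
  | none => T
  | some γ => mutate T γ

/-- One step of a mutation sequence on a single arc. -/
noncomputable def stepA (T : Set Arc) : Option Arc → Arc → Arc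
  | none, δ => δ
  | some γ, δ => mutArc T γ δ

/-- `iterT T θ k` is `μ_{θ_k} ∘ ⋯ ∘ μ_{θ_1}(T)`. Sequences (finite or infinite) are
encoded as `θ : ℕ → Option Arc` whose support is downward closed. -/
noncomputable def iterT (T : Set Arc) (θ : ℕ → Option Arc) : ℕ → Set Arc
  | 0 => T
  | k + 1 => stepT (iterT T θ k) (θ k)

/-- `iterA T θ γ k` is `μ_{θ_k} ∘ ⋯ ∘ μ_{θ_1}(γ)`. -/
noncomputable def iterA (T : Set Arc) (θ : ℕ → Option Arc) (γ : Arc) : ℕ → Arc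
  | 0 => γ
  | k + 1 => stepA (iterT T θ k) (θ k) (iterA T θ γ k)

/-- `θ` is a `T`-admissible sequence: its support is downward closed (so it is a genuine
finite or infinite sequence), each entry is mutable in the triangulation obtained by the
previous mutations, and the mutation of each arc of `T` along `θ` eventually stabilizes. -/
def Admissible (T : Set Arc) (θ : ℕ → Option Arc) : Prop :=
  (∀ i, θ i = none → θ (i + 1) = none) ∧
  (∀ i γ, θ i = some γ → IsMutable (iterT T θ i) γ) ∧
  (∀ γ ∈ T, ∃ l, ∀ k, l ≤ k → iterA T θ γ k = iterA T θ γ l)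

/-- `μ_θ(γ)`: the stable value of the mutation of the arc `γ` along the sequence `θ`. -/
noncomputable def seqLimit (T : Set Arc) (θ : ℕ → Option Arc) (γ : Arc) : Arc :=
  if h : ∃ l, ∀ k, l ≤ k → iterA T θ γ k = iterA T θ γ l
  then iterA T θ γ h.choose else γ

/-- `μ_θ(T)`: the mutation of `T` along the sequence `θ`. -/
noncomputable def mutSeq (T : Set Arc) (θ : ℕ → Option Arc) : Set Arc :=
  seqLimit T θ '' T

/-- The sequence `θ` leaves the arc `γ` untouched. -/
def Untouched (T : Set Arc) (θ : ℕ → Option Arc) (γ : Arc) : Prop :=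
  ∀ l, iterA T θ γ l = γ

/-- The quadrilateral `S(γ)` of a mutable arc `γ` in `T`: with `v₁ < v₂ < v₃ < v₄` the four
endpoints of the two diagonals `γ` and `flipArc T γ`, it consists of those of the pairs
`(v₁,v₂), (v₂,v₃), (v₃,v₄), (v₁,v₄)` that are arcs. -/
noncomputable def quad (T : Set Arc) (γ : Arc) : Set Arc :=
  let γ' := flipArc T γ
  let vs : Vtx × Vtx × Vtx × Vtx :=
    if γ.src < γ'.src then (γ.src, γ'.src, γ.tgt, γ'.tgt) else (γ'.src, γ.src, γ'.tgt, γ.tgt)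
  {δ : Arc | (δ.src = vs.1 ∧ δ.tgt = vs.2.1) ∨ (δ.src = vs.2.1 ∧ δ.tgt = vs.2.2.1) ∨
    (δ.src = vs.2.2.1 ∧ δ.tgt = vs.2.2.2) ∨ (δ.src = vs.1 ∧ δ.tgt = vs.2.2.2)}

/-- The set `𝒫` of Prüfer curves compatible with every arc of `S`. -/
def pruferCompletion (S : Set Arc) : Set Arc :=
  {γ | (∃ k : ℤ, γ = prufer k) ∧ ∀ x ∈ S, ¬ Cross γ x}

/-- The set `𝒜̃` of adic curves compatible with every arc of `S ∪ 𝒫(S)`. -/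
def adicCompletion' (S : Set Arc) : Set Arc :=
  {γ | (∃ k : ℤ, γ = adic k) ∧ ∀ x ∈ S ∪ pruferCompletion S, ¬ Cross γ x}

/-- The completed (Prüfer) mutation `μ̄_θ(T) = μ_θ(T) ∪ 𝒫 ∪ 𝒜̃` of `T` along `θ`. -/
noncomputable def completedMut (T : Set Arc) (θ : ℕ → Option Arc) : Set Arc :=
  mutSeq T θ ∪ pruferCompletion (mutSeq T θ) ∪ adicCompletion' (mutSeq T θ)

/-- The tower of triangulations associated to a composition of completed mutations. -/
noncomputable def compIter (T : Set Arc) (Θ : ℕ → Option (ℕ → Option Arc)) : ℕ → Set Arc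
  | 0 => T
  | k + 1 =>
    match Θ k with
    | none => compIter T Θ k
    | some θ => completedMut (compIter T Θ k) θ

/-- `Θ` is a `T`-admissible composition of completed mutations. -/
def CompAdmissible (T : Set Arc) (Θ : ℕ → Option (ℕ → Option Arc)) : Prop :=
  (∀ i, Θ i = none → Θ (i + 1) = none) ∧
  ∀ i θ, Θ i = some θ → Admissible (compIter T Θ i) θ

/-- The transfinite mutation of `T` along the composition `Θ`. -/
noncomputable def transfiniteMut (T : Set Arc) (Θ : ℕ → Option (ℕ → Option Arc)) : Set Arc :=
  ⋃ i, {γ ∈ compIter T Θ i |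
    ∀ k, i ≤ k → ∀ θ, Θ k = some θ → Untouched (compIter T Θ k) θ γ}

lemma vInt_lt_vInt_iff (a b : ℤ) : vInt a < vInt b ↔ a < b := by
  simp [vInt]

lemma vtx_cases (v : Vtx) : v = vBot ∨ v = vTop ∨ ∃ q : ℤ, v = vInt q := by
  induction v using WithBot.recBotCoe with
  | bot => exact Or.inl rfl
  | coe w =>
    induction w using WithTop.recTopCoe with
    | top => exact Or.inr (Or.inl rfl)
    | coe q => exact Or.inr (Or.inr ⟨q, rfl⟩)

/-- If `T` has a right fountain at `n ∈ ℤ` then `π_n ∈ T`; if `T` has a left fountain at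
`n ∈ ℤ` then `α_n ∈ T`. -/
theorem statement1 (T : Set Arc) (hT : IsTriangulation T) (n : ℤ) :
    (RightFountainInt T n → prufer n ∈ T) ∧ (LeftFountainInt T n → adic n ∈ T) := by
  constructor
  · intro hF
    apply hT.2
    intro x hx hc
    rcases hc with ⟨_, _, h3⟩ | ⟨h1, h2, h3⟩
    · change vTop < x.tgt at h3
      rcases vtx_cases x.tgt with h | h | ⟨q, h⟩
      · rw [h] at h3
        exact lt_asymm h3 vBot_lt_vTop
      · rw [h] at h3
        exact lt_irrefl _ h3
      · rw [h] at h3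
        exact lt_asymm h3 (vInt_lt_vTop q)
    · change x.src < vInt n at h1
      change vInt n < x.tgt at h2
      change x.tgt < vTop at h3
      rcases vtx_cases x.tgt with h | h | ⟨q, h⟩
      · rw [h] at h2
        exact lt_asymm h2 (vBot_lt_vInt n)
      · rw [h] at h3
        exact lt_irrefl _ h3
      · apply hF
        apply (Set.finite_Icc n q).subset
        rintro p ⟨δ, hδ, hs, ht⟩
        have hsep := δ.sep n p hs ht
        refine ⟨by omega, ?_⟩
        by_contra hlt
        refine hT.1 x hx δ hδ (Or.inl ?_)
        rw [hs, ht]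
        refine ⟨h1, h2, ?_⟩
        rw [h, vInt_lt_vInt_iff]
        omega
  · intro hF
    apply hT.2
    intro x hx hc
    rcases hc with ⟨h1, h2, h3⟩ | ⟨h1, _, _⟩
    · change vBot < x.src at h1
      change x.src < vInt n at h2
      change vInt n < x.tgt at h3
      rcases vtx_cases x.src with h | h | ⟨q, h⟩
      · rw [h] at h1
        exact lt_irrefl _ h1
      · rw [h] at h2
        exact lt_asymm h2 (vInt_lt_vTop n)
      · apply hF
        apply (Set.finite_Icc q n).subset
        rintro p ⟨δ, hδ, hs, ht⟩
        have hsep := δ.sep p n hs ht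
        refine ⟨?_, by omega⟩
        by_contra hlt
        refine hT.1 x hx δ hδ (Or.inr ?_)
        rw [hs, ht]
        refine ⟨?_, h2, h3⟩
        rw [h, vInt_lt_vInt_iff]
        omega
    · exact not_lt_bot h1
end

section
/- Let T be a triangulation of the ∞-gon, and let α, β ∈ T be mutable arcs with α ∉ {β} ∪ S(β). Then α is mutable in μ_β(T), β is mutable in μ_α(T), and mutations commute: μ_α(μ_β(T)) = μ_β(μ_α(T)), and for every γ ∈ T the arc obtained by mutating γ at α in T and then at β in μ_α(T) equals the arc obtained by mutating γ at β in T and then at α in μ_β(T). -/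
open scoped Classical

/-- An arc of the ∞-gon: a pair of integers `(i,j)` with `i ≤ j − 2`. -/
structure ArcZ where
  src : ℤ
  tgt : ℤ
  sep : src + 2 ≤ tgt

/-- Two arcs `(i,j)` and `(k,l)` cross if `i < k < j < l` or `k < i < l < j`. -/
def CrossZ (x y : ArcZ) : Prop :=
  (x.src < y.src ∧ y.src < x.tgt ∧ x.tgt < y.tgt) ∨
  (y.src < x.src ∧ x.src < y.tgt ∧ y.tgt < x.tgt)

/-- A triangulation of the ∞-gon: a maximal set of pairwise compatible
(= non-crossing) arcs. -/
def IsTriangulationZ (T : Set ArcZ) : Prop :=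
  (∀ x ∈ T, ∀ y ∈ T, ¬ CrossZ x y) ∧
  ∀ γ : ArcZ, (∀ x ∈ T, ¬ CrossZ γ x) → γ ∈ T

/-- `T` has a right fountain at `n`. -/
def RightFountainZ (T : Set ArcZ) (n : ℤ) : Prop :=
  {p : ℤ | ∃ γ ∈ T, γ.src = n ∧ γ.tgt = p}.Infinite

/-- `T` has a left fountain at `n`. -/
def LeftFountainZ (T : Set ArcZ) (n : ℤ) : Prop :=
  {p : ℤ | ∃ γ ∈ T, γ.src = p ∧ γ.tgt = n}.Infinite

/-- `T` is locally finite if every integer is an endpoint of only finitely many arcs of `T`. -/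
def LocallyFinZ (T : Set ArcZ) : Prop :=
  ∀ v : ℤ, {γ | γ ∈ T ∧ (γ.src = v ∨ γ.tgt = v)}.Finite

/-- `γ'` is an exchange partner for `γ` relative to `T`:
it is distinct from `γ` and `(T \ {γ}) ∪ {γ'}` is again a triangulation. -/
def MutExchangeZ (T : Set ArcZ) (γ γ' : ArcZ) : Prop :=
  γ' ≠ γ ∧ IsTriangulationZ ((T \ {γ}) ∪ {γ'})

/-- `γ` is a mutable arc of `T`. -/
def IsMutableZ (T : Set ArcZ) (γ : ArcZ) : Prop :=
  γ ∈ T ∧ ∃ γ', MutExchangeZ T γ γ'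

/-- The (unique) replacement arc of `γ` in `T`, when `γ` is mutable. -/
noncomputable def flipArcZ (T : Set ArcZ) (γ : ArcZ) : ArcZ :=
  if h : ∃ γ', MutExchangeZ T γ γ' then h.choose else γ

/-- The mutation `μ_γ(T)` of `T` at `γ`. -/
noncomputable def mutateZ (T : Set ArcZ) (γ : ArcZ) : Set ArcZ :=
  (T \ {γ}) ∪ {flipArcZ T γ}

/-- `μ_γ(δ)`: the effect of the mutation of `T` at `γ` on the arc `δ`. -/
noncomputable def mutArcZ (T : Set ArcZ) (γ δ : ArcZ) : ArcZ :=
  if δ = γ then flipArcZ T γ else δ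

/-- One step of a mutation sequence on a set of arcs (`none` = no entry). -/
noncomputable def stepTZ (T : Set ArcZ) : Option ArcZ → Set ArcZ
  | none => T
  | some γ => mutateZ T γ

/-- One step of a mutation sequence on a single arc. -/
noncomputable def stepAZ (T : Set ArcZ) : Option ArcZ → ArcZ → ArcZ
  | none, δ => δ
  | some γ, δ => mutArcZ T γ δ

/-- `iterTZ T θ k` is `μ_{θ_k} ∘ ⋯ ∘ μ_{θ_1}(T)`. Sequences (finite or infinite) are
encoded as `θ : ℕ → Option ArcZ` whose support is downward closed. -/
noncomputable def iterTZ (T : Set ArcZ) (θ : ℕ → Option ArcZ) : ℕ → Set ArcZ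
  | 0 => T
  | k + 1 => stepTZ (iterTZ T θ k) (θ k)

/-- `iterAZ T θ γ k` is `μ_{θ_k} ∘ ⋯ ∘ μ_{θ_1}(γ)`. -/
noncomputable def iterAZ (T : Set ArcZ) (θ : ℕ → Option ArcZ) (γ : ArcZ) : ℕ → ArcZ
  | 0 => γ
  | k + 1 => stepAZ (iterTZ T θ k) (θ k) (iterAZ T θ γ k)

/-- `θ` is a `T`-admissible sequence: its support is downward closed (so it is a genuine
finite or infinite sequence), each entry is mutable in the triangulation obtained by the
previous mutations, and the mutation of each arc of `T` along `θ` eventually stabilizes. -/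
def AdmissibleZ (T : Set ArcZ) (θ : ℕ → Option ArcZ) : Prop :=
  (∀ i, θ i = none → θ (i + 1) = none) ∧
  (∀ i γ, θ i = some γ → IsMutableZ (iterTZ T θ i) γ) ∧
  (∀ γ ∈ T, ∃ l, ∀ k, l ≤ k → iterAZ T θ γ k = iterAZ T θ γ l)

/-- `μ_θ(γ)`: the stable value of the mutation of the arc `γ` along the sequence `θ`. -/
noncomputable def seqLimitZ (T : Set ArcZ) (θ : ℕ → Option ArcZ) (γ : ArcZ) : ArcZ :=
  if h : ∃ l, ∀ k, l ≤ k → iterAZ T θ γ k = iterAZ T θ γ l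
  then iterAZ T θ γ h.choose else γ

/-- `μ_θ(T)`: the mutation of `T` along the sequence `θ`. -/
noncomputable def mutSeqZ (T : Set ArcZ) (θ : ℕ → Option ArcZ) : Set ArcZ :=
  seqLimitZ T θ '' T

/-- The sequence `θ` leaves the arc `γ` untouched. -/
def UntouchedZ (T : Set ArcZ) (θ : ℕ → Option ArcZ) (γ : ArcZ) : Prop :=
  ∀ l, iterAZ T θ γ l = γ

/-- The quadrilateral `S(γ)` of a mutable arc `γ` in `T`: with `v₁ < v₂ < v₃ < v₄` the four
endpoints of the two diagonals `γ` and `flipArcZ T γ`, it consists of those of the pairs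
`(v₁,v₂), (v₂,v₃), (v₃,v₄), (v₁,v₄)` that are arcs. -/
noncomputable def quadZ (T : Set ArcZ) (γ : ArcZ) : Set ArcZ :=
  let γ' := flipArcZ T γ
  let vs : ℤ × ℤ × ℤ × ℤ :=
    if γ.src < γ'.src then (γ.src, γ'.src, γ.tgt, γ'.tgt) else (γ'.src, γ.src, γ'.tgt, γ.tgt)
  {δ : ArcZ | (δ.src = vs.1 ∧ δ.tgt = vs.2.1) ∨ (δ.src = vs.2.1 ∧ δ.tgt = vs.2.2.1) ∨
    (δ.src = vs.2.2.1 ∧ δ.tgt = vs.2.2.2) ∨ (δ.src = vs.1 ∧ δ.tgt = vs.2.2.2)}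

/-- The restriction `T|_S` of a set of arcs to a set `S` of vertices. -/
def restrictZ (T : Set ArcZ) (S : Set ℤ) : Set ArcZ :=
  {γ | γ ∈ T ∧ γ.src ∈ S ∧ γ.tgt ∈ S}

/-- `T ≤_s T'`: there is a `T`-admissible sequence `θ` with `μ_θ(T) = T'`. -/
def leS (T T' : Set ArcZ) : Prop :=
  ∃ θ : ℕ → Option ArcZ, AdmissibleZ T θ ∧ mutSeqZ T θ = T'

theorem ArcZ.ext_aux {x y : ArcZ} (h1 : x.src = y.src) (h2 : x.tgt = y.tgt) : x = y := by
  cases x; cases y; simp_all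

/-- the sides of the quadrilateral with diagonals `g` and `h` -/
def sideQ (g h s : ArcZ) : Prop :=
  let a := min g.src h.src
  let b := max g.src h.src
  let c := min g.tgt h.tgt
  let d := max g.tgt h.tgt
  (s.src = a ∧ s.tgt = b) ∨ (s.src = b ∧ s.tgt = c) ∨ (s.src = c ∧ s.tgt = d) ∨
    (s.src = a ∧ s.tgt = d)

theorem sideQ_symm {g h s : ArcZ} (H : sideQ g h s) : sideQ h g s := by
  simpa [sideQ, min_comm, max_comm] using H

theorem CrossZ.symm {g h : ArcZ} (H : CrossZ g h) : CrossZ h g := by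
  unfold CrossZ at *; omega

theorem side_not_cross {g h s x : ArcZ} (hgh : CrossZ g h) (hs : sideQ g h s)
    (hg : ¬ CrossZ x g) (hh : ¬ CrossZ x h) : ¬ CrossZ s x := by
  have := g.sep; have := h.sep; have := s.sep; have := x.sep
  unfold CrossZ sideQ at *
  rcases hgh with hgh | hgh <;> omega

theorem side_not_cross_diag {g h s : ArcZ} (hgh : CrossZ g h) (hs : sideQ g h s) :
    ¬ CrossZ s g := by
  have := g.sep; have := h.sep; have := s.sep
  unfold CrossZ sideQ at *
  rcases hgh with hgh | hgh <;> omega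

theorem not_cross_side {a b : ℤ} {x : ArcZ} (H : ∀ s : ArcZ, s.src = a → s.tgt = b → ¬ CrossZ x s) :
    ¬ (x.src < a ∧ a < x.tgt ∧ x.tgt < b) ∧ ¬ (a < x.src ∧ x.src < b ∧ b < x.tgt) := by
  by_cases h : a + 2 ≤ b
  · have := H ⟨a, b, h⟩ rfl rfl
    unfold CrossZ at this
    simp only at this
    omega
  · omega

theorem eq_diag {g h x : ArcZ} (hgh : CrossZ g h) (hxg : CrossZ x g)
    (H : ∀ s, sideQ g h s → ¬ CrossZ x s) : x = h := by
  have h1 := not_cross_side (x := x) (a := min g.src h.src) (b := max g.src h.src)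
    (fun s e1 e2 => H s (Or.inl ⟨e1, e2⟩))
  have h2 := not_cross_side (x := x) (a := max g.src h.src) (b := min g.tgt h.tgt)
    (fun s e1 e2 => H s (Or.inr (Or.inl ⟨e1, e2⟩)))
  have h3 := not_cross_side (x := x) (a := min g.tgt h.tgt) (b := max g.tgt h.tgt)
    (fun s e1 e2 => H s (Or.inr (Or.inr (Or.inl ⟨e1, e2⟩))))
  have h4 := not_cross_side (x := x) (a := min g.src h.src) (b := max g.tgt h.tgt)
    (fun s e1 e2 => H s (Or.inr (Or.inr (Or.inr ⟨e1, e2⟩))))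
  clear H
  unfold CrossZ at *
  have key : x.src = h.src ∧ x.tgt = h.tgt := by
    rcases hgh with hgh | hgh
    · rw [min_eq_left (by omega), max_eq_right (by omega)] at *
      omega
    · rw [min_eq_right (by omega), max_eq_left (by omega)] at *
      omega
  exact ArcZ.ext_aux key.1 key.2

section
variable {T : Set ArcZ} {g h : ArcZ}

theorem exch_not_mem (hT : IsTriangulationZ T) (hg : g ∈ T) (H : MutExchangeZ T g h) : h ∉ T := by
  intro hh
  have hmem : g ∈ (T \ {g}) ∪ {h} := by
    apply H.2.2
    rintro x (hx | hx)
    · exact hT.1 g hg x hx.1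
    · rw [Set.mem_singleton_iff.1 hx]; exact hT.1 g hg h hh
  rcases hmem with hm | hm
  · exact hm.2 rfl
  · exact H.1 (Set.mem_singleton_iff.1 hm).symm

theorem exch_compat (H : MutExchangeZ T g h) {x : ArcZ} (hx : x ∈ T) (hxg : x ≠ g) :
    ¬ CrossZ x h :=
  H.2.1 x (Or.inl ⟨hx, hxg⟩) h (Or.inr rfl)

theorem exch_cross (hT : IsTriangulationZ T) (hg : g ∈ T) (H : MutExchangeZ T g h) :
    CrossZ g h := by
  by_contra hc
  apply exch_not_mem hT hg H
  apply hT.2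
  intro x hx hcx
  by_cases hxg : x = g
  · subst hxg; exact hc hcx.symm
  · exact exch_compat H hx hxg hcx.symm

theorem side_mem (hT : IsTriangulationZ T) (hg : g ∈ T) (H : MutExchangeZ T g h) {s : ArcZ}
    (hs : sideQ g h s) : s ∈ T := by
  have hc := exch_cross hT hg H
  apply hT.2
  intro x hx
  by_cases hxg : x = g
  · subst hxg; exact side_not_cross_diag hc hs
  · exact side_not_cross hc hs (hT.1 x hx g hg) (exch_compat H hx hxg)

theorem side_ne (hgh : CrossZ g h) {s : ArcZ} (hs : sideQ g h s) : s ≠ g := by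
  rintro rfl
  unfold CrossZ sideQ at *
  rcases hgh with hgh | hgh <;> omega

theorem exch_unique (hT : IsTriangulationZ T) (hg : g ∈ T) (H : MutExchangeZ T g h) {k : ArcZ}
    (K : MutExchangeZ T g k) : k = h := by
  have hc := exch_cross hT hg H
  apply eq_diag hc (exch_cross hT hg K).symm
  intro s hs hx
  exact exch_compat K (side_mem hT hg H hs) (side_ne hc hs) hx.symm

theorem flip_spec (H : ∃ k, MutExchangeZ T g k) : MutExchangeZ T g (flipArcZ T g) := by
  unfold flipArcZ
  rw [dif_pos H]
  exact H.choose_spec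

theorem flip_eq (hT : IsTriangulationZ T) (hg : g ∈ T) (H : MutExchangeZ T g h) :
    flipArcZ T g = h :=
  exch_unique hT hg H (flip_spec ⟨h, H⟩)

theorem side_quad (hgh : CrossZ g (flipArcZ T g)) {s : ArcZ} (hs : sideQ g (flipArcZ T g) s) :
    s ∈ quadZ T g := by
  unfold CrossZ sideQ at *
  unfold quadZ
  simp only [Set.mem_setOf_eq]
  split_ifs <;> simp only <;> omega

end

theorem statement6 (T : Set ArcZ) (hT : IsTriangulationZ T) (α β : ArcZ)
    (hα : IsMutableZ T α) (hβ : IsMutableZ T β)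
    (hne : α ∉ insert β (quadZ T β)) :
    IsMutableZ (mutateZ T β) α ∧ IsMutableZ (mutateZ T α) β ∧
    mutateZ (mutateZ T β) α = mutateZ (mutateZ T α) β ∧
    ∀ γ ∈ T, mutArcZ (mutateZ T α) β (mutArcZ T α γ) =
      mutArcZ (mutateZ T β) α (mutArcZ T β γ) := by
  have A := flip_spec hα.2
  have B := flip_spec hβ.2
  have hq : ∀ s, sideQ β (flipArcZ T β) s → s ≠ α := by
    rintro s hs rfl
    exact hne (Or.inr (side_quad (exch_cross hT hβ.1 B) hs))
  have hab : α ≠ β := fun e => hne (Or.inl e)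
  have mA : mutateZ T α = (T \ {α}) ∪ {flipArcZ T α} := rfl
  have mB : mutateZ T β = (T \ {β}) ∪ {flipArcZ T β} := rfl
  generalize flipArcZ T α = a at *
  generalize flipArcZ T β = b at *
  have hαT := hα.1
  have hβT := hβ.1
  have ca := exch_cross hT hαT A
  have cb := exch_cross hT hβT B
  have na := exch_not_mem hT hαT A
  have nb := exch_not_mem hT hβT B
  have sb : ∀ s, sideQ β b s → s ∈ T := fun s hs => side_mem hT hβT B hs
  have aβ : a ≠ β := fun e => na (e ▸ hβT)
  have bα : b ≠ α := fun e => nb (e ▸ hαT)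
  have nab : ¬ CrossZ a b := by
    intro hc
    apply aβ
    apply eq_diag cb.symm hc
    intro s hs hx
    have hs' := sideQ_symm hs
    exact exch_compat A (sb s hs') (hq s hs') hx.symm
  have hU : IsTriangulationZ ((T \ {α, β}) ∪ {a, b}) := by
    constructor
    · have tA := fun x (hx : x ∈ T) (h : x ≠ α) => exch_compat A hx h
      have tB := fun x (hx : x ∈ T) (h : x ≠ β) => exch_compat B hx h
      have irr : ∀ x, ¬ CrossZ x x := by intro x; unfold CrossZ; omega
      rintro x (⟨hx, hx'⟩ | rfl | rfl) y (⟨hy, hy'⟩ | rfl | rfl)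
      · exact hT.1 x hx y hy
      · exact tA x hx (fun e => hx' (Or.inl e))
      · exact tB x hx (fun e => hx' (Or.inr e))
      · exact fun c => tA y hy (fun e => hy' (Or.inl e)) c.symm
      · exact irr _
      · exact nab
      · exact fun c => tB y hy (fun e => hy' (Or.inr e)) c.symm
      · exact fun c => nab c.symm
      · exact irr _
    · intro γ hγ
      by_cases hc : CrossZ γ β
      · have : γ = b := by
          apply eq_diag cb hc
          intro s hs
          apply hγ
          left
          refine ⟨sb s hs, ?_⟩
          rintro (e | e)
          · exact hq s hs e
          · exact side_ne cb hs e
        exact Or.inr (Or.inr this)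
      · have hm : γ ∈ (T \ {α}) ∪ {a} := by
          apply A.2.2
          rintro x (⟨hx, hx'⟩ | rfl)
          · by_cases e : x = β
            · rw [e]; exact hc
            · exact hγ x (Or.inl ⟨hx, by rintro (e' | e'); exacts [hx' e', e e']⟩)
          · exact hγ _ (Or.inr (Or.inl rfl))
        rcases hm with ⟨hm, hm'⟩ | hm
        · refine Or.inl ⟨hm, ?_⟩
          rintro (e | e)
          · exact hm' e
          · rw [Set.mem_singleton_iff.1 e] at hγ
            exact hγ b (Or.inr (Or.inr rfl)) cb
        · exact Or.inr (Or.inl hm)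
  have eB : (mutateZ T β \ {α}) ∪ {a} = (T \ {α, β}) ∪ {a, b} := by
    rw [mB]; ext x
    simp only [Set.mem_union, Set.mem_diff, Set.mem_singleton_iff, Set.mem_insert_iff]
    grind
  have eA : (mutateZ T α \ {β}) ∪ {b} = (T \ {α, β}) ∪ {a, b} := by
    rw [mA]; ext x
    simp only [Set.mem_union, Set.mem_diff, Set.mem_singleton_iff, Set.mem_insert_iff]
    grind
  have XB : MutExchangeZ (mutateZ T β) α a := ⟨A.1, eB ▸ hU⟩
  have XA : MutExchangeZ (mutateZ T α) β b := ⟨B.1, eA ▸ hU⟩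
  have memB : α ∈ mutateZ T β := by rw [mB]; exact Or.inl ⟨hαT, hab⟩
  have memA : β ∈ mutateZ T α := by rw [mA]; exact Or.inl ⟨hβT, fun e => hab e.symm⟩
  have fB : flipArcZ (mutateZ T β) α = a := flip_eq (by rw [mB]; exact B.2) memB XB
  have fA : flipArcZ (mutateZ T α) β = b := flip_eq (by rw [mA]; exact A.2) memA XA
  have f1 : flipArcZ T α = a := flip_eq hT hαT A
  have f2 : flipArcZ T β = b := flip_eq hT hβT B
  refine ⟨⟨memB, a, XB⟩, ⟨memA, b, XA⟩, ?_, ?_⟩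
  · conv_lhs => rw [mutateZ, fB, eB]
    conv_rhs => rw [mutateZ, fA, eA]
  · intro γ _
    simp only [mutArcZ, fA, fB, f1, f2]
    grind
end

section
/- Let T be a triangulation of the completed ∞-gon, let θ = (θ_i)_{i∈I} be a T-admissible sequence, and let δ ∈ T be mutable with replacement arc δ'. Assume θ leaves every arc in S(δ) ∪ {δ} untouched. Then θ is a μ_δ(T)-admissible sequence, and the mutation of μ_δ(T) along θ equals (μ_θ(T) \ {δ}) ∪ {δ'}. -/
open scoped Classical

/-- `s` is a side of the quadrilateral with vertices `a, b, c, d`. -/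
def SideV (a b c d : Vtx) (s : Arc) : Prop :=
  (s.src = a ∧ s.tgt = b) ∨ (s.src = b ∧ s.tgt = c) ∨
    (s.src = c ∧ s.tgt = d) ∨ (s.src = a ∧ s.tgt = d)

/-- `s` is a side of the quadrilateral with diagonals `x, y`. -/
def Side (x y s : Arc) : Prop :=
  (x.src < y.src ∧ SideV x.src y.src x.tgt y.tgt s) ∨
  (¬ x.src < y.src ∧ SideV y.src x.src y.tgt x.tgt s)

lemma quad_iff (T : Set Arc) (γ s : Arc) : s ∈ quad T γ ↔ Side γ (flipArc T γ) s := by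
  unfold quad Side SideV
  by_cases h : γ.src < (flipArc T γ).src <;> simp [h]

lemma arc_ext {x y : Arc} (h1 : x.src = y.src) (h2 : x.tgt = y.tgt) : x = y := by
  cases x; cases y; simp_all

lemma edge_or (u v : Vtx) (h : u < v) :
    (∀ w, u < w → w < v → False) ∨ ∃ s : Arc, s.src = u ∧ s.tgt = v := by
  by_cases H : ∀ m n : ℤ, u = vInt m → v = vInt n → m + 2 ≤ n
  · exact Or.inr ⟨⟨u, v, h, H⟩, rfl, rfl⟩
  · left
    push Not at H
    obtain ⟨m, n, rfl, rfl, hmn⟩ := H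
    intro w h1 h2
    induction w using WithBot.recBotCoe with
    | bot => exact not_lt_bot h1
    | coe w =>
      induction w using WithTop.recTopCoe with
      | top =>
        have := h2.trans (vInt_lt_vTop n)
        exact lt_irrefl _ this
      | coe w =>
        simp only [vInt, WithBot.coe_lt_coe, WithTop.coe_lt_coe] at h1 h2
        omega

lemma cross_comm {x y : Arc} : Cross x y ↔ Cross y x := by
  unfold Cross; tauto

lemma cross_irrefl (x : Arc) : ¬ Cross x x := by
  unfold Cross; simp

lemma not_in_side {u v : Vtx} (huv : u < v) {x : Arc}
    (hs : ∀ s : Arc, s.src = u → s.tgt = v → ¬ Cross x s) :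
    ¬ (u < x.src ∧ x.src < v ∧ v < x.tgt) ∧ ¬ (x.src < u ∧ u < x.tgt ∧ x.tgt < v) := by
  rcases edge_or u v huv with h | ⟨s, rfl, rfl⟩
  · exact ⟨fun h' => h _ h'.1 h'.2.1, fun h' => h _ h'.2.1 h'.2.2⟩
  · have := hs s rfl rfl
    unfold Cross at this
    tauto

lemma sideV_unique {a b c d : Vtx} (hab : a < b) (hbc : b < c) (hcd : c < d) (x : Arc)
    (hs : ∀ s, SideV a b c d s → ¬ Cross x s) :
    (((x.src < b ∧ b < x.tgt ∧ x.tgt < d) ∨ (b < x.src ∧ x.src < d ∧ d < x.tgt)) →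
      x.src = a ∧ x.tgt = c) ∧
    (((x.src < a ∧ a < x.tgt ∧ x.tgt < c) ∨ (a < x.src ∧ x.src < c ∧ c < x.tgt)) →
      x.src = b ∧ x.tgt = d) := by
  have h1 := not_in_side hab (x := x) (fun s h h' => hs s (Or.inl ⟨h, h'⟩))
  have h2 := not_in_side hbc (x := x) (fun s h h' => hs s (Or.inr (Or.inl ⟨h, h'⟩)))
  have h3 := not_in_side hcd (x := x) (fun s h h' => hs s (Or.inr (Or.inr (Or.inl ⟨h, h'⟩))))
  have h4 := not_in_side (hab.trans (hbc.trans hcd)) (x := x)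
    (fun s h h' => hs s (Or.inr (Or.inr (Or.inr ⟨h, h'⟩))))
  have h5 := x.lt
  clear hs
  generalize x.src = p at *
  generalize x.tgt = q at *
  grind

/-- Only `x` crosses `y` without crossing the sides. -/
lemma side_unique {x y z : Arc} (hxy : Cross x y) (hzy : Cross z y)
    (hs : ∀ s, Side x y s → ¬ Cross z s) : z = x := by
  rcases hxy with ⟨h1, h2, h3⟩ | ⟨h1, h2, h3⟩
  · have := (sideV_unique h1 h2 h3 z (fun s h => hs s (Or.inl ⟨h1, h⟩))).1
      (by unfold Cross at hzy; tauto)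
    exact arc_ext this.1 this.2
  · have := (sideV_unique h1 h2 h3 z (fun s h => hs s (Or.inr ⟨not_lt.2 h1.le, h⟩))).2
      (by unfold Cross at hzy; tauto)
    exact arc_ext this.1 this.2

lemma side_symm {x y s : Arc} (hxy : Cross x y) : Side x y s ↔ Side y x s := by
  unfold Side
  rcases hxy with ⟨h1, _, _⟩ | ⟨h1, _, _⟩ <;> simp [h1, h1.le]

lemma side_unique' {x y z : Arc} (hxy : Cross x y) (hzx : Cross z x)
    (hs : ∀ s, Side x y s → ¬ Cross z s) : z = y :=
  side_unique (cross_comm.1 hxy) hzx (fun s h => hs s ((side_symm hxy).2 h))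

lemma sideV_cross {a b c d : Vtx} (hab : a < b) (hbc : b < c) (hcd : c < d) {s z : Arc}
    (hs : SideV a b c d s) (hz : Cross z s) :
    ((z.src < a ∧ a < z.tgt ∧ z.tgt < c) ∨ (a < z.src ∧ z.src < c ∧ c < z.tgt)) ∨
    ((z.src < b ∧ b < z.tgt ∧ z.tgt < d) ∨ (b < z.src ∧ z.src < d ∧ d < z.tgt)) := by
  unfold Cross at hz
  unfold SideV at hs
  have h5 := z.lt
  rcases hs with ⟨h, h'⟩ | ⟨h, h'⟩ | ⟨h, h'⟩ | ⟨h, h'⟩ <;> rw [h, h'] at hz <;> clear h h' <;>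
  generalize z.src = p at * <;> generalize z.tgt = q at * <;> grind

lemma side_cross {x y s z : Arc} (hxy : Cross x y) (hs : Side x y s) (hz : Cross z s) :
    Cross z x ∨ Cross z y := by
  rcases hxy with ⟨h1, h2, h3⟩ | ⟨h1, h2, h3⟩
  · have hs' : SideV x.src y.src x.tgt y.tgt s := by
      simpa [Side, h1] using hs
    have := sideV_cross h1 h2 h3 hs' hz
    unfold Cross; tauto
  · have hs' : SideV y.src x.src y.tgt x.tgt s := by
      simpa [Side, h1.le, not_lt.2 h1.le] using hs
    have := sideV_cross h1 h2 h3 hs' hz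
    unfold Cross; tauto

lemma side_not_cross_s8 {x y s : Arc} (hxy : Cross x y) (hs : Side x y s) :
    ¬ Cross x s ∧ ¬ Cross y s := by
  unfold Cross Side SideV at *
  have := x.lt
  have := y.lt
  generalize x.src = a at *
  generalize x.tgt = b at *
  generalize y.src = c at *
  generalize y.tgt = d at *
  generalize s.src = e at *
  generalize s.tgt = f at *
  grind

lemma side_ne_s8 {x y s : Arc} (hxy : Cross x y) (hs : Side x y s) : s ≠ x := by
  rintro rfl
  exact (side_not_cross_s8 hxy hs).2 (cross_comm.1 hxy)

lemma exch_of_sides {T : Set Arc} (hT : IsTriangulation T) {x y : Arc} (hx : x ∈ T)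
    (hxy : Cross x y) (hs : ∀ s, Side x y s → s ∈ T) : MutExchange T x y := by
  have key : ∀ z ∈ T, z ≠ x → ¬ Cross z y := fun z hz hzx hc =>
    hzx (side_unique hxy hc (fun s h => hT.1 z hz s (hs s h)))
  refine ⟨?_, ?_, ?_⟩
  · rintro rfl
    exact cross_irrefl _ hxy
  · rintro z (⟨hz, hzx⟩ | rfl) w (⟨hw, hwx⟩ | rfl)
    · exact hT.1 z hz w hw
    · exact key z hz hzx
    · exact fun h => key w hw hwx (cross_comm.1 h)
    · exact cross_irrefl _
  · intro z hz
    by_cases hc : Cross z x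
    · right
      exact side_unique' hxy hc (fun s h => hz s (Or.inl ⟨hs s h, side_ne_s8 hxy h⟩))
    · left
      refine ⟨hT.2 z fun w hw => ?_, ?_⟩
      · by_cases hwx : w = x
        · rwa [hwx]
        · exact hz w (Or.inl ⟨hw, hwx⟩)
      · rintro rfl
        exact hz y (Or.inr rfl) hxy

lemma exch_not_mem_s8 {T : Set Arc} (hT : IsTriangulation T) {x y : Arc} (hx : x ∈ T)
    (h : MutExchange T x y) : y ∉ T := by
  intro hy
  have : x ∈ (T \ {x}) ∪ {y} := by
    refine h.2.2 x ?_
    rintro w (⟨hw, _⟩ | rfl)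
    · exact hT.1 x hx w hw
    · exact hT.1 x hx w hy
  rcases this with ⟨_, h'⟩ | h'
  · exact h' rfl
  · exact h.1 h'.symm

lemma exch_cross_s8 {T : Set Arc} (hT : IsTriangulation T) {x y : Arc} (hx : x ∈ T)
    (h : MutExchange T x y) : Cross x y := by
  by_contra hc
  apply exch_not_mem_s8 hT hx h
  apply hT.2
  intro w hw
  by_cases hwx : w = x
  · rw [hwx]; exact fun h' => hc (cross_comm.1 h')
  · exact h.2.1 y (Or.inr rfl) w (Or.inl ⟨hw, hwx⟩)

lemma exch_sides {T : Set Arc} (hT : IsTriangulation T) {x y : Arc} (hx : x ∈ T)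
    (h : MutExchange T x y) : ∀ s, Side x y s → s ∈ T := by
  have hc := exch_cross_s8 hT hx h
  intro s hs
  apply hT.2
  intro w hw hsw
  by_cases hwx : w = x
  · subst hwx
    exact (side_not_cross_s8 hc hs).1 (cross_comm.1 hsw)
  · rcases side_cross hc hs (cross_comm.1 hsw) with h' | h'
    · exact hT.1 _ hw _ hx h'
    · exact h.2.1 w (Or.inl ⟨hw, hwx⟩) y (Or.inr rfl) h'

lemma exch_unique_s8 {T : Set Arc} (hT : IsTriangulation T) {x y z : Arc} (hx : x ∈ T)
    (h : MutExchange T x y) (h' : MutExchange T x z) : z = y := by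
  have hc := exch_cross_s8 hT hx h
  refine side_unique' hc (cross_comm.1 (exch_cross_s8 hT hx h')) fun s hs => ?_
  exact h'.2.1 z (Or.inr rfl) s (Or.inl ⟨exch_sides hT hx h s hs, side_ne_s8 hc hs⟩)

lemma flip_exch {T : Set Arc} {x : Arc} (h : IsMutable T x) : MutExchange T x (flipArc T x) := by
  unfold flipArc
  rw [dif_pos h.2]
  exact h.2.choose_spec

lemma flip_eq_s8 {T : Set Arc} (hT : IsTriangulation T) {x y : Arc} (hx : x ∈ T)
    (h : MutExchange T x y) : flipArc T x = y :=
  exch_unique_s8 hT hx h (flip_exch ⟨hx, y, h⟩)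

/-- Commutation of two mutations. -/
lemma exch_comm {T : Set Arc} (hT : IsTriangulation T) {d d' g g' : Arc} (hd : d ∈ T)
    (hg : g ∈ T) (hdd : MutExchange T d d') (hgg : MutExchange T g g') (hne : g ≠ d)
    (hns : ¬ Side d d' g) :
    ((T \ {d} ∪ {d'}) \ {g} ∪ {g'} = (T \ {g} ∪ {g'}) \ {d} ∪ {d'}) ∧
    MutExchange (T \ {d} ∪ {d'}) g g' ∧ g ∈ T \ {d} ∪ {d'} := by
  have h1 : d' ≠ g := fun h => exch_not_mem_s8 hT hd hdd (h ▸ hg)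
  have h2 : g' ≠ d := fun h => exch_not_mem_s8 hT hg hgg (h ▸ hd)
  have heq : (T \ {d} ∪ {d'}) \ {g} ∪ {g'} = (T \ {g} ∪ {g'}) \ {d} ∪ {d'} := by
    ext z
    simp only [Set.mem_union, Set.mem_sdiff, Set.mem_singleton_iff]
    grind
  refine ⟨heq, ⟨hgg.1, ?_⟩, Or.inl ⟨hg, hne⟩⟩
  rw [heq]
  refine (exch_of_sides hgg.2 (Or.inl ⟨hd, hne.symm⟩) (exch_cross_s8 hT hd hdd) ?_).2
  intro s hs
  exact Or.inl ⟨exch_sides hT hd hdd s hs, fun h => hns (h ▸ hs)⟩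

lemma iter_tri {T : Set Arc} (hT : IsTriangulation T) {θ : ℕ → Option Arc}
    (hθ : Admissible T θ) (k : ℕ) : IsTriangulation (iterT T θ k) := by
  induction k with
  | zero => exact hT
  | succ k ih =>
    rw [iterT]
    cases h : θ k with
    | none => exact ih
    | some g => exact (flip_exch (hθ.2.1 k g h)).2

lemma untouched_ne {T : Set Arc} {θ : ℕ → Option Arc} (hθ : Admissible T θ) {s : Arc}
    (hu : Untouched T θ s) (k : ℕ) : θ k ≠ some s := by
  intro h
  have h1 := hu (k + 1)
  rw [iterA, hu k, h] at h1
  simp only [stepA, mutArc, if_true] at h1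
  exact (flip_exch (hθ.2.1 k s h)).1 h1

lemma untouched_mem {T : Set Arc} {θ : ℕ → Option Arc} (hθ : Admissible T θ) {s : Arc}
    (hs : s ∈ T) (hu : Untouched T θ s) (k : ℕ) : s ∈ iterT T θ k := by
  induction k with
  | zero => exact hs
  | succ k ih =>
    rw [iterT]
    cases h : θ k with
    | none => exact ih
    | some g =>
      refine Or.inl ⟨ih, fun h' => untouched_ne hθ hu k ?_⟩
      rw [h, Set.mem_singleton_iff.1 h']

lemma seqLimit_eq {T : Set Arc} {θ : ℕ → Option Arc} {x : Arc} (h : Untouched T θ x) :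
    seqLimit T θ x = x := by
  unfold seqLimit
  split_ifs
  · exact h _
  · rfl

/-- If `θ` is a `T`-admissible sequence, `δ ∈ T` is mutable with replacement arc `δ'`, and
`θ` leaves every arc of `S(δ) ∪ {δ}` untouched, then `θ` is `μ_δ(T)`-admissible and
`μ_θ(μ_δ(T)) = (μ_θ(T) \ {δ}) ∪ {δ'}`. -/
theorem statement8 (T : Set Arc) (hT : IsTriangulation T) (θ : ℕ → Option Arc)
    (hθ : Admissible T θ) (δ : Arc) (hδ : IsMutable T δ)
    (hun : ∀ γ ∈ insert δ (quad T δ), Untouched T θ γ) :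
    Admissible (mutate T δ) θ ∧
    mutSeq (mutate T δ) θ = (mutSeq T θ \ {δ}) ∪ {flipArc T δ} := by
  have hdT := hδ.1
  have hex := flip_exch hδ
  have hsT := exch_sides hT hdT hex
  have hcr := exch_cross_s8 hT hdT hex
  have hq : ∀ s, Side δ (flipArc T δ) s → Untouched T θ s := fun s hs =>
    hun s (Or.inr ((quad_iff T δ s).2 hs))
  have hud : Untouched T θ δ := hun δ (Or.inl rfl)
  generalize hd' : flipArc T δ = δ' at *
  have hmut : mutate T δ = T \ {δ} ∪ {δ'} := by rw [mutate, hd']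
  rw [hmut]
  have htri := iter_tri hT hθ
  have hdk := untouched_mem hθ hdT hud
  have hexk : ∀ k, MutExchange (iterT T θ k) δ δ' := fun k =>
    exch_of_sides (htri k) (hdk k) hcr fun s hs => untouched_mem hθ (hsT s hs) (hq s hs) k
  have hstep : ∀ k g, θ k = some g → g ≠ δ ∧ ¬ Side δ δ' g := fun k g hg =>
    ⟨fun h => untouched_ne hθ hud k (h ▸ hg), fun h => untouched_ne hθ (hq g h) k hg⟩
  have hcomm := fun k g (hg : θ k = some g) =>
    exch_comm (htri k) (hdk k) (hθ.2.1 k g hg).1 (hexk k) (flip_exch (hθ.2.1 k g hg))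
      (hstep k g hg).1 (hstep k g hg).2
  have hflip : ∀ k g, θ k = some g →
      flipArc (iterT T θ k \ {δ} ∪ {δ'}) g = flipArc (iterT T θ k) g := fun k g hg =>
    flip_eq_s8 (hexk k).2 (hcomm k g hg).2.2 (hcomm k g hg).2.1
  have hiter : ∀ k, iterT (T \ {δ} ∪ {δ'}) θ k = iterT T θ k \ {δ} ∪ {δ'} := by
    intro k
    induction k with
    | zero => rfl
    | succ k ih =>
      rw [iterT, ih, iterT]
      cases h : θ k with
      | none => rfl
      | some g =>
        simp only [stepT, mutate]
        rw [hflip k g h]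
        exact (hcomm k g h).1
  have hA : ∀ x, iterA (T \ {δ} ∪ {δ'}) θ x = iterA T θ x := by
    intro x
    funext k
    induction k with
    | zero => rfl
    | succ k ih =>
      rw [iterA, ih, iterA, hiter k]
      cases h : θ k with
      | none => rfl
      | some g =>
        simp only [stepA, mutArc]
        rw [hflip k g h]
  have hud' : Untouched T θ δ' := by
    intro k
    induction k with
    | zero => rfl
    | succ k ih =>
      rw [iterA, ih]
      cases h : θ k with
      | none => rfl
      | some g =>
        simp only [stepA, mutArc]
        rw [if_neg]
        rintro rfl
        exact exch_not_mem_s8 (htri k) (hdk k) (hexk k) (hθ.2.1 k _ h).1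
  have hne : ∀ x, x ≠ δ → ∀ k, iterA T θ x k ≠ δ := by
    intro x hx k
    induction k with
    | zero => exact hx
    | succ k ih =>
      rw [iterA]
      cases h : θ k with
      | none => exact ih
      | some g =>
        simp only [stepA, mutArc]
        split_ifs with h'
        · intro h2
          have hm := hθ.2.1 k g h
          exact exch_not_mem_s8 (htri k) hm.1 (flip_exch hm) (h2 ▸ hdk k)
        · exact ih
  have hL : seqLimit (T \ {δ} ∪ {δ'}) θ = seqLimit T θ := by
    funext x
    unfold seqLimit
    simp only [hA]
  have hLne : ∀ x, x ≠ δ → seqLimit T θ x ≠ δ := by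
    intro x hx
    unfold seqLimit
    split_ifs
    · exact hne x hx _
    · exact hx
  refine ⟨⟨hθ.1, ?_, ?_⟩, ?_⟩
  · intro k g hg
    rw [hiter k]
    exact ⟨(hcomm k g hg).2.2, _, (hcomm k g hg).2.1⟩
  · intro x hx
    rw [hA]
    rcases hx with hx | rfl
    · exact hθ.2.2 x hx.1
    · exact ⟨0, fun k _ => by rw [hud' k, hud' 0]⟩
  · unfold mutSeq
    rw [hL, Set.image_union, Set.image_singleton, seqLimit_eq hud']
    congr 1
    ext z
    constructor
    · rintro ⟨x, ⟨hx, hxd⟩, rfl⟩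
      exact ⟨⟨x, hx, rfl⟩, hLne x hxd⟩
    · rintro ⟨⟨x, hx, rfl⟩, hz⟩
      refine ⟨x, ⟨hx, ?_⟩, rfl⟩
      rintro rfl
      exact hz (seqLimit_eq hud)
end
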